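/- arXiv:2510.26262 — 4 statements merged into one kernel-verified Lean document; each statement's English description precedes it below -/
import Mathlib

section
/- Let k0 > 0, let 0 < z_b < z, let x, ν ∈ ℝ, and let x1 ≤ x2 be real numbers (the lower and upper edges of the knife-edge obstacle). Set A := k0·z/(2·z_b·(z − z_b)) and μ := (z_b·x + (z − z_b)·ν)/z. Then, as R → ∞, the truncated integral ∫_{−R}^{x1} exp(−i·k0·(ξ − ν)²/(2·z_b))·exp(−i·k0·(x − ξ)²/(2·(z − z_b))) dξ + ∫_{x2}^{R} exp(−i·k0·(ξ − ν)²/(2·z_b))·exp(−i·k0·(x − ξ)²/(2·(z − z_b))) dξ converges to (1/2)·√(π/(i·A)) · exp(−i·k0·(ν − x)²/(2·z)) · [1 + Erf(√(i·A)·(x1 − μ)) + Erfc(√(i·A)·(x2 − μ))]. -/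
open MeasureTheory intervalIntegral Filter Complex

/-- The complex error function along the straight segment from `0` to `w`:
`Erf(w) = (2/√π) ∫_{t ∈ [0,1]} w · exp(−(t·w)²) dt`. -/
noncomputable def cErf (w : ℂ) : ℂ :=
  (2 / Real.sqrt Real.pi : ℝ) * ∫ t in (0:ℝ)..1, w * Complex.exp (-((t : ℂ) * w) ^ 2)

/-- The complementary complex error function `Erfc(w) = 1 − Erf(w)`. -/
noncomputable def cErfc (w : ℂ) : ℂ := 1 - cErf w

lemma ke_norm_exp_le (b : ℂ) (hb : 0 ≤ b.re) (t : ℝ) :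
    ‖Complex.exp (-b * (t : ℂ) ^ 2)‖ ≤ 1 := by
  rw [Complex.norm_exp]
  apply Real.exp_le_one_iff.mpr
  have : (-b * (t : ℂ) ^ 2).re = -(b.re * t ^ 2) := by
    rw [← Complex.ofReal_pow, Complex.re_mul_ofReal]; simp
  rw [this]
  have := mul_nonneg hb (sq_nonneg t)
  linarith

lemma ke_cont (b : ℂ) : Continuous fun t : ℝ => Complex.exp (-b * (t : ℂ) ^ 2) := by
  fun_prop

lemma ke_tail (b : ℂ) (hb0 : b ≠ 0) (hb : 0 ≤ b.re) (R S : ℝ) (hR : 0 < R) (hRS : R ≤ S) :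
    ‖∫ t in R..S, Complex.exp (-b * (t : ℂ) ^ 2)‖ ≤ 1 / (‖b‖ * R) := by
  have hS : 0 < S := lt_of_lt_of_le hR hRS
  have hn : 0 < ‖b‖ := norm_pos_iff.mpr hb0
  have hpos : ∀ t ∈ Set.uIcc R S, 0 < t := by
    intro t ht
    rw [Set.uIcc_of_le hRS] at ht
    exact lt_of_lt_of_le hR ht.1
  set u : ℝ → ℂ := fun t => -Complex.exp (-b * (t : ℂ) ^ 2) / (2 * b * t) with hu
  set v : ℝ → ℂ := fun t => Complex.exp (-b * (t : ℂ) ^ 2) / (2 * b * t ^ 2) with hv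
  have hvc : ContinuousOn v (Set.uIcc R S) := by
    apply ContinuousOn.div
    · exact (ke_cont b).continuousOn
    · fun_prop
    · intro t ht
      have : (t : ℂ) ≠ 0 := by exact_mod_cast (hpos t ht).ne'
      simp [hb0, this]
  have hvi : IntervalIntegrable v volume R S := hvc.intervalIntegrable
  have hei : IntervalIntegrable (fun t : ℝ => Complex.exp (-b * (t : ℂ) ^ 2)) volume R S :=
    (ke_cont b).intervalIntegrable _ _
  have hder : ∀ t ∈ Set.uIcc R S, HasDerivAt u (Complex.exp (-b * (t : ℂ) ^ 2) + v t) t := by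
    intro t ht
    have ht0 : (t : ℂ) ≠ 0 := by exact_mod_cast (hpos t ht).ne'
    have h1 : HasDerivAt (fun w : ℂ => -Complex.exp (-b * w ^ 2) / (2 * b * w))
        (Complex.exp (-b * (t : ℂ) ^ 2) + v t) (t : ℂ) := by
      have h2 : HasDerivAt (fun w : ℂ => -b * w ^ 2) (-b * (2 * (t : ℂ))) (t : ℂ) := by
        simpa using (hasDerivAt_pow 2 (t : ℂ)).const_mul (-b)
      have h3 : HasDerivAt (fun w : ℂ => 2 * b * w) (2 * b) (t : ℂ) := by
        simpa using (hasDerivAt_id (t : ℂ)).const_mul (2 * b)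
      have h4 := (h2.cexp.neg).div h3 (by simp [hb0, ht0])
      refine h4.congr_deriv ?_
      simp only [hv, Pi.neg_apply]
      field_simp
      ring
    exact h1.comp_ofReal
  have hFTC := intervalIntegral.integral_eq_sub_of_hasDerivAt hder (hei.add hvi)
  rw [intervalIntegral.integral_add hei hvi] at hFTC
  have hun : ∀ t : ℝ, 0 < t → ‖u t‖ ≤ 1 / (2 * ‖b‖ * t) := by
    intro t ht
    simp only [hu, norm_div, norm_neg, norm_mul, Complex.norm_real, Real.norm_eq_abs, abs_of_pos ht,
      Complex.norm_ofNat]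
    gcongr
    exact ke_norm_exp_le b hb t
  have hw : ∀ t ∈ Set.uIcc R S,
      HasDerivAt (fun t : ℝ => -(1 / (2 * ‖b‖)) * t⁻¹) (1 / (2 * ‖b‖ * t ^ 2)) t := by
    intro t ht
    have ht0 := (hpos t ht).ne'
    refine ((hasDerivAt_inv ht0).const_mul _).congr_deriv ?_
    field_simp
  have hwi : IntervalIntegrable (fun t : ℝ => 1 / (2 * ‖b‖ * t ^ 2)) volume R S := by
    apply ContinuousOn.intervalIntegrable
    apply ContinuousOn.div
    · fun_prop
    · fun_prop
    · intro t ht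
      have := hpos t ht
      positivity
  have hwI := intervalIntegral.integral_eq_sub_of_hasDerivAt hw hwi
  have hvn : ‖∫ t in R..S, v t‖ ≤ ∫ t in R..S, 1 / (2 * ‖b‖ * t ^ 2) := by
    apply intervalIntegral.norm_integral_le_of_norm_le hRS _ hwi
    refine Filter.Eventually.of_forall fun t ht => ?_
    have ht0 : 0 < t := lt_trans hR ht.1
    simp only [hv, norm_div, norm_mul, norm_pow, Complex.norm_real, Real.norm_eq_abs,
      abs_of_pos ht0, Complex.norm_ofNat]
    gcongr
    exact ke_norm_exp_le b hb t
  have hE : (∫ t in R..S, Complex.exp (-b * (t : ℂ) ^ 2)) = u S - u R - ∫ t in R..S, v t := by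
    rw [← hFTC]; ring
  rw [hE]
  calc _ ≤ ‖u S‖ + ‖u R‖ + ‖∫ t in R..S, v t‖ :=
        (norm_sub_le _ _).trans (by gcongr; exact norm_sub_le _ _)
    _ ≤ 1 / (2 * ‖b‖ * S) + 1 / (2 * ‖b‖ * R)
        + (-(1 / (2 * ‖b‖)) * S⁻¹ - -(1 / (2 * ‖b‖)) * R⁻¹) := by
        rw [← hwI]
        exact add_le_add (add_le_add (hun S hS) (hun R hR)) hvn
    _ = 1 / (‖b‖ * R) := by field_simp; ring

lemma ke_pos (b : ℂ) (hb : 0 < b.re) (R : ℝ) (hR : 0 < R) :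
    ‖((Real.pi : ℂ) / b) ^ (1 / 2 : ℂ) / 2 - ∫ t in (0:ℝ)..R, Complex.exp (-b * (t : ℂ) ^ 2)‖
      ≤ 1 / (‖b‖ * R) := by
  have hb0 : b ≠ 0 := by rintro rfl; simp at hb
  have hT := intervalIntegral_tendsto_integral_Ioi (0:ℝ)
    (integrable_cexp_neg_mul_sq hb).integrableOn tendsto_id
  rw [integral_gaussian_complex_Ioi hb] at hT
  have hT2 := (hT.sub_const (∫ t in (0:ℝ)..R, Complex.exp (-b * (t : ℂ) ^ 2))).norm
  refine le_of_tendsto hT2 ?_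
  filter_upwards [eventually_ge_atTop R] with S hS
  rw [id, intervalIntegral.integral_interval_sub_left ((ke_cont b).intervalIntegrable _ _)
    ((ke_cont b).intervalIntegrable _ _)]
  exact ke_tail b hb0 hb.le R S hR hS

lemma ke_bdry (A : ℝ) (hA : 0 < A) (R : ℝ) (hR : 0 < R) :
    ‖((Real.pi : ℂ) / (Complex.I * A)) ^ (1 / 2 : ℂ) / 2
      - ∫ t in (0:ℝ)..R, Complex.exp (-(Complex.I * A) * (t : ℂ) ^ 2)‖ ≤ 1 / (A * R) := by
  set b : ℝ → ℂ := fun ε => Complex.I * A + ε with hbdef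
  have hbc : Continuous b := by fun_prop
  have hb0 : b 0 = Complex.I * A := by simp [hbdef]
  have hne : Complex.I * (A : ℂ) ≠ 0 := by simp [hA.ne']
  have hnorm : ‖Complex.I * (A : ℂ)‖ = A := by simp [abs_of_pos hA]
  have h1 : Tendsto (fun ε : ℝ => 1 / (‖b ε‖ * R)) (nhdsWithin 0 (Set.Ioi 0))
      (nhds (1 / (A * R))) := by
    have : ContinuousAt (fun ε : ℝ => 1 / (‖b ε‖ * R)) 0 := by
      apply ContinuousAt.div
      · fun_prop
      · fun_prop
      · rw [hb0, hnorm]; positivity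
    have h := this.tendsto
    simp only [hb0, hnorm] at h
    exact h.mono_left nhdsWithin_le_nhds
  have h2 : Tendsto (fun ε : ℝ => ‖((Real.pi : ℂ) / b ε) ^ (1 / 2 : ℂ) / 2
      - ∫ t in (0:ℝ)..R, Complex.exp (-(b ε) * (t : ℂ) ^ 2)‖) (nhdsWithin 0 (Set.Ioi 0))
      (nhds ‖((Real.pi : ℂ) / (Complex.I * A)) ^ (1 / 2 : ℂ) / 2
      - ∫ t in (0:ℝ)..R, Complex.exp (-(Complex.I * A) * (t : ℂ) ^ 2)‖) := by
    have hint : Continuous fun ε : ℝ => ∫ t in (0:ℝ)..R, Complex.exp (-(b ε) * (t : ℂ) ^ 2) := by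
      apply intervalIntegral.continuous_parametric_intervalIntegral_of_continuous'
      fun_prop
    have hdiv : ContinuousAt (fun ε : ℝ => (Real.pi : ℂ) / b ε) 0 := by
      apply ContinuousAt.div
      · fun_prop
      · fun_prop
      · rw [hb0]; exact hne
    have hcp : ContinuousAt (fun ε : ℝ => ((Real.pi : ℂ) / b ε) ^ (1 / 2 : ℂ)) 0 := by
      apply ContinuousAt.cpow hdiv continuousAt_const
      rw [hb0]
      right
      have : (Real.pi : ℂ) / (Complex.I * A) = ((-(Real.pi / A) : ℝ) : ℂ) * Complex.I := by
        have : (A : ℂ) ≠ 0 := by exact_mod_cast hA.ne'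
        push_cast
        field_simp
        simp
      rw [this, Complex.im_ofReal_mul]
      simp [Real.pi_ne_zero, hA.ne']
    have := ((hcp.div_const 2).sub hint.continuousAt).norm.tendsto
    rw [← hb0]
    exact this.mono_left nhdsWithin_le_nhds
  refine le_of_tendsto_of_tendsto h2 h1 ?_
  filter_upwards [self_mem_nhdsWithin] with ε hε
  refine ke_pos (b ε) ?_ R hR
  simpa [hbdef] using hε

lemma ke_fresnel (A : ℝ) (hA : 0 < A) :
    Tendsto (fun R : ℝ => ∫ t in (0:ℝ)..R, Complex.exp (-(Complex.I * A) * (t : ℂ) ^ 2)) atTop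
      (nhds (((Real.pi : ℂ) / (Complex.I * A)) ^ (1 / 2 : ℂ) / 2)) := by
  rw [tendsto_iff_norm_sub_tendsto_zero]
  have hlim : Tendsto (fun R : ℝ => 1 / (A * R)) atTop (nhds 0) :=
    (tendsto_const_nhds).div_atTop (tendsto_id.const_mul_atTop hA)
  refine squeeze_zero' (Filter.Eventually.of_forall fun _ => norm_nonneg _) ?_ hlim
  filter_upwards [eventually_gt_atTop 0] with R hR
  rw [norm_sub_rev]
  exact ke_bdry A hA R hR

lemma ke_sqrt_mul (A : ℝ) (hA : 0 < A) :
    ((Real.pi : ℂ) / (Complex.I * A)) ^ (1 / 2 : ℂ) * (Complex.I * A) ^ (1 / 2 : ℂ)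
      = (Real.sqrt Real.pi : ℂ) := by
  have hne : Complex.I * (A : ℂ) ≠ 0 := by simp [hA.ne']
  have harg : (Complex.I * (A : ℂ)).arg ≠ Real.pi := by
    rw [mul_comm, Complex.arg_real_mul _ hA, Complex.arg_I]
    have := Real.pi_pos
    linarith
  have hpi : (Real.pi : ℂ) ≠ 0 := by exact_mod_cast Real.pi_ne_zero
  rw [Complex.cpow_def_of_ne_zero (div_ne_zero hpi hne), Complex.cpow_def_of_ne_zero hne,
    ← Complex.exp_add, div_eq_mul_inv, Complex.log_ofReal_mul Real.pi_pos (inv_ne_zero hne),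
    Complex.log_inv _ harg, Real.sqrt_eq_rpow, Complex.ofReal_cpow Real.pi_pos.le,
    Complex.cpow_def_of_ne_zero hpi, Complex.ofReal_log Real.pi_pos.le]
  congr 1
  push_cast
  ring

lemma ke_erf (A : ℝ) (hA : 0 < A) (y : ℝ) :
    ((Real.pi : ℂ) / (Complex.I * A)) ^ (1 / 2 : ℂ) / 2
      * cErf ((Complex.I * A) ^ (1 / 2 : ℂ) * (y : ℂ))
      = ∫ t in (0:ℝ)..y, Complex.exp (-(Complex.I * A) * (t : ℂ) ^ 2) := by
  have hs := ke_sqrt_mul A hA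
  set s := (Complex.I * (A : ℂ)) ^ (1 / 2 : ℂ) with hsdef
  set p := ((Real.pi : ℂ) / (Complex.I * A)) ^ (1 / 2 : ℂ)
  have hs2 : s ^ 2 = Complex.I * A := by
    rw [hsdef, one_div]
    exact Complex.cpow_nat_inv_pow _ two_ne_zero
  have hsp : (Real.sqrt Real.pi : ℂ) ≠ 0 := by
    exact_mod_cast (Real.sqrt_pos.mpr Real.pi_pos).ne'
  unfold cErf
  rw [intervalIntegral.integral_const_mul]
  have h1 := intervalIntegral.smul_integral_comp_mul_right (a := (0:ℝ)) (b := 1)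
    (fun t : ℝ => Complex.exp (-(Complex.I * A) * (t : ℂ) ^ 2)) y
  rw [zero_mul, one_mul] at h1
  rw [← h1]
  have h2 : ∀ t : ℝ, Complex.exp (-((t : ℂ) * (s * y)) ^ 2)
      = Complex.exp (-(Complex.I * A) * ((t * y : ℝ) : ℂ) ^ 2) := by
    intro t
    congr 1
    rw [← hs2]; push_cast; ring
  simp only [h2, Complex.real_smul]
  set J := ∫ t in (0:ℝ)..1, Complex.exp (-(Complex.I * A) * ((t * y : ℝ) : ℂ) ^ 2)
  push_cast
  calc _ = (p * s) * (1 / (Real.sqrt Real.pi : ℂ)) * (y * J) := by ring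
    _ = _ := by rw [hs]; field_simp

lemma ke_odd (b : ℂ) (R : ℝ) : (∫ t in (-R)..(0:ℝ), Complex.exp (-b * (t : ℂ) ^ 2))
    = ∫ t in (0:ℝ)..R, Complex.exp (-b * (t : ℂ) ^ 2) := by
  have := intervalIntegral.integral_comp_neg (a := 0) (b := R)
    (fun t : ℝ => Complex.exp (-b * (t : ℂ) ^ 2))
  rw [neg_zero] at this
  rw [← this]
  simp

/-- Proposition 1 (knife-edge diffraction kernel): with
`A = k0·z/(2·z_b·(z − z_b))` and `μ = (z_b·x + (z − z_b)·ν)/z`, the truncated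
integral of the product of the two Fresnel chirps over the unobstructed region
`(−R, x1) ∪ (x2, R)` converges, as `R → ∞`, to
`(1/2)·√(π/(i·A))·exp(−i·k0·(ν−x)²/(2·z))·[1 + Erf(√(i·A)·(x1−μ)) + Erfc(√(i·A)·(x2−μ))]`. -/
theorem knife_edge_kernel_closed_form
    (k0 z zb x ν x1 x2 : ℝ) (hk0 : 0 < k0) (hzb : 0 < zb) (hz : zb < z)
    (h12 : x1 ≤ x2) :
    Tendsto (fun R : ℝ =>
        (∫ ξ in (-R)..x1,
          Complex.exp (-Complex.I * (k0 : ℂ) * ((ξ : ℂ) - (ν : ℂ)) ^ 2 / (2 * (zb : ℂ)))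
            * Complex.exp (-Complex.I * (k0 : ℂ) * ((x : ℂ) - (ξ : ℂ)) ^ 2
                / (2 * ((z : ℂ) - (zb : ℂ)))))
        + ∫ ξ in x2..R,
          Complex.exp (-Complex.I * (k0 : ℂ) * ((ξ : ℂ) - (ν : ℂ)) ^ 2 / (2 * (zb : ℂ)))
            * Complex.exp (-Complex.I * (k0 : ℂ) * ((x : ℂ) - (ξ : ℂ)) ^ 2
                / (2 * ((z : ℂ) - (zb : ℂ))))) atTop
      (nhds ((1 / 2 : ℂ)
        * ((Real.pi : ℂ) / (Complex.I * ((k0 * z / (2 * zb * (z - zb)) : ℝ) : ℂ))) ^ (1 / 2 : ℂ)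
        * Complex.exp (-Complex.I * (k0 : ℂ) * ((ν : ℂ) - (x : ℂ)) ^ 2 / (2 * (z : ℂ)))
        * (1
          + cErf ((Complex.I * ((k0 * z / (2 * zb * (z - zb)) : ℝ) : ℂ)) ^ (1 / 2 : ℂ)
              * (((x1 : ℝ) : ℂ) - (((zb * x + (z - zb) * ν) / z : ℝ) : ℂ)))
          + cErfc ((Complex.I * ((k0 * z / (2 * zb * (z - zb)) : ℝ) : ℂ)) ^ (1 / 2 : ℂ)
              * (((x2 : ℝ) : ℂ) - (((zb * x + (z - zb) * ν) / z : ℝ) : ℂ)))))) := by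
  have hz0 : 0 < z := hzb.trans hz
  have hd : 0 < z - zb := sub_pos.mpr hz
  have hA : 0 < k0 * z / (2 * zb * (z - zb)) := by positivity
  have hfun : ∀ ξ : ℝ,
      Complex.exp (-Complex.I * (k0 : ℂ) * ((ξ : ℂ) - (ν : ℂ)) ^ 2 / (2 * (zb : ℂ)))
            * Complex.exp (-Complex.I * (k0 : ℂ) * ((x : ℂ) - (ξ : ℂ)) ^ 2
                / (2 * ((z : ℂ) - (zb : ℂ))))
      = Complex.exp (-Complex.I * (k0 : ℂ) * ((ν : ℂ) - (x : ℂ)) ^ 2 / (2 * (z : ℂ)))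
        * Complex.exp (-(Complex.I * ((k0 * z / (2 * zb * (z - zb)) : ℝ) : ℂ))
          * ((ξ - (zb * x + (z - zb) * ν) / z : ℝ) : ℂ) ^ 2) := by
    intro ξ
    rw [← Complex.exp_add, ← Complex.exp_add]
    congr 1
    have h1 : (z : ℂ) ≠ 0 := by exact_mod_cast hz0.ne'
    have h2 : (zb : ℂ) ≠ 0 := by exact_mod_cast hzb.ne'
    have h3 : (z : ℂ) - (zb : ℂ) ≠ 0 := by exact_mod_cast hd.ne'
    push_cast
    field_simp
    ring
  simp only [hfun, intervalIntegral.integral_const_mul]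
  set A := k0 * z / (2 * zb * (z - zb)) with hAdef
  set m := (zb * x + (z - zb) * ν) / z with hm
  set E := Complex.exp (-Complex.I * (k0 : ℂ) * ((ν : ℂ) - (x : ℂ)) ^ 2 / (2 * (z : ℂ)))
  set g : ℝ → ℂ := fun t => Complex.exp (-(Complex.I * A) * (t : ℂ) ^ 2) with hg
  have hgi : ∀ a b : ℝ, IntervalIntegrable g volume a b := fun a b =>
    (ke_cont (Complex.I * A)).intervalIntegrable a b
  have hF := ke_fresnel A hA
  have hR1 : Tendsto (fun R : ℝ => R + m) atTop atTop := tendsto_atTop_add_const_right _ _ tendsto_id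
  have hR2 : Tendsto (fun R : ℝ => R - m) atTop atTop := by
    simpa [sub_eq_add_neg] using tendsto_atTop_add_const_right atTop (-m) tendsto_id
  have e1 := ke_erf A hA (x1 - m)
  have e2 := ke_erf A hA (x2 - m)
  have hlim := (((hF.comp hR1).add_const (∫ t in (0:ℝ)..(x1 - m), g t)).add
    ((hF.comp hR2).sub_const (∫ t in (0:ℝ)..(x2 - m), g t))).const_mul E
  have key : ∀ L L2 : ℂ, L = L2 → ∀ f h : ℝ → ℂ, Tendsto f atTop (nhds L) → (∀ R, f R = h R) →
      Tendsto h atTop (nhds L2) := by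
    intro L L2 hL f h hf hfh
    rw [← hL]; exact hf.congr hfh
  refine key _ _ ?_ _ _ hlim ?_
  swap
  · intro R
    have i1 : (∫ ξ in (-R)..x1, g (ξ - m)) = (∫ t in (0:ℝ)..(R + m), g t)
        + ∫ t in (0:ℝ)..(x1 - m), g t := by
      rw [intervalIntegral.integral_comp_sub_right g m, ← ke_odd (Complex.I * A) (R + m)]
      rw [intervalIntegral.integral_add_adjacent_intervals (hgi _ _) (hgi _ _)]
      congr 1; ring
    have i2 : (∫ ξ in x2..R, g (ξ - m)) = (∫ t in (0:ℝ)..(R - m), g t)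
        - ∫ t in (0:ℝ)..(x2 - m), g t := by
      rw [intervalIntegral.integral_comp_sub_right g m,
        intervalIntegral.integral_interval_sub_left (hgi _ _) (hgi _ _)]
    change _ = E * (∫ ξ in (-R)..x1, g (ξ - m)) + E * (∫ ξ in x2..R, g (ξ - m))
    rw [i1, i2]
    simp only [Function.comp, hg]
    ring
  · simp only [hg]
    rw [← e1, ← e2]
    push_cast
    unfold cErfc
    ring
end

section
/- Let k0 > 0, let 0 < z_b < z, let x, ν ∈ ℝ, and let x1 ∈ ℝ. Set A := k0·z/(2·z_b·(z − z_b)) and μ := (z_b·x + (z − z_b)·ν)/z. Then, as R → ∞, ∫_{−R}^{x1} exp(−i·k0·(ξ − ν)²/(2·z_b))·exp(−i·k0·(x − ξ)²/(2·(z − z_b))) dξ converges to (1/2)·√(π/(i·A)) · exp(−i·k0·(ν − x)²/(2·z)) · [1 + Erf(√(i·A)·(x1 − μ))]. -/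
open MeasureTheory intervalIntegral Filter Complex

open Set Topology in
lemma fres_tail_bound {b : ℂ} (hb : 0 ≤ b.re) (hb0 : b ≠ 0) {T S : ℝ} (hT : 0 < T) (hS : T ≤ S) :
    ‖∫ u in T..S, Complex.exp (-b * (u : ℂ) ^ 2)‖ ≤ 1 / (‖b‖ * T) := by
  have hpos : ∀ u ∈ uIcc T S, 0 < u := by
    intro u hu
    rw [uIcc_of_le hS] at hu
    exact lt_of_lt_of_le hT hu.1
  have hS0 : 0 < S := lt_of_lt_of_le hT hS
  have hle1 : ∀ u : ℝ, ‖Complex.exp (-b * (u : ℂ) ^ 2)‖ ≤ 1 := by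
    intro u
    rw [norm_cexp_neg_mul_sq]
    rw [Real.exp_le_one_iff]
    nlinarith [mul_nonneg hb (sq_nonneg u)]
  have hE : IntervalIntegrable (fun u : ℝ => Complex.exp (-b * (u : ℂ) ^ 2)) volume T S := by
    apply Continuous.intervalIntegrable
    fun_prop
  have hcinv : ContinuousOn (fun u : ℝ => (u ^ 2)⁻¹) (uIcc T S) := by
    apply ContinuousOn.inv₀ (by fun_prop)
    intro u hu
    exact pow_ne_zero _ (hpos u hu).ne'
  have hG : IntervalIntegrable
      (fun u : ℝ => Complex.exp (-b * (u : ℂ) ^ 2) * (((u ^ 2)⁻¹ : ℝ) : ℂ)) volume T S := by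
    apply ContinuousOn.intervalIntegrable
    apply ContinuousOn.mul (by fun_prop)
    exact Complex.continuous_ofReal.comp_continuousOn hcinv
  have hR : IntervalIntegrable (fun u : ℝ => (u ^ 2)⁻¹) volume T S := hcinv.intervalIntegrable
  have hRint : ∫ u in T..S, (u ^ 2)⁻¹ = T⁻¹ - S⁻¹ := by
    have := intervalIntegral.integral_eq_sub_of_hasDerivAt
      (f := fun u : ℝ => -u⁻¹) (f' := fun u : ℝ => (u ^ 2)⁻¹) (a := T) (b := S)
      (fun u hu => by
        exact (hasDerivAt_inv (hpos u hu).ne').neg.congr_deriv (by simp)) hR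
    rw [this]; ring
  have hW := intervalIntegral.integral_eq_sub_of_hasDerivAt
      (f := fun u : ℝ => Complex.exp (-b * (u : ℂ) ^ 2) * ((u⁻¹ : ℝ) : ℂ))
      (f' := fun u : ℝ => (-2 * b) * Complex.exp (-b * (u : ℂ) ^ 2)
          - Complex.exp (-b * (u : ℂ) ^ 2) * (((u ^ 2)⁻¹ : ℝ) : ℂ)) (a := T) (b := S)
      (fun u hu => by
        have hu0 := (hpos u hu).ne'
        have h1 : HasDerivAt (fun u : ℝ => Complex.exp (-b * (u : ℂ) ^ 2))
            (Complex.exp (-b * (u : ℂ) ^ 2) * (-b * (2 * (u : ℂ)))) u := by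
          have : HasDerivAt (fun w : ℂ => Complex.exp (-b * w ^ 2))
            (Complex.exp (-b * (u : ℂ) ^ 2) * (-b * (2 * (u : ℂ)))) (u : ℂ) := by
            simpa using (((hasDerivAt_id (u : ℂ)).pow 2).const_mul (-b)).cexp
          exact this.comp_ofReal
        have h2 : HasDerivAt (fun u : ℝ => ((u⁻¹ : ℝ) : ℂ)) ((-(u ^ 2)⁻¹ : ℝ) : ℂ) u :=
          (hasDerivAt_inv hu0).ofReal_comp
        refine (h1.mul h2).congr_deriv ?_
        have : (u : ℂ) ≠ 0 := by exact_mod_cast hu0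
        push_cast
        field_simp
        ring)
      ((hE.const_mul _).sub hG)
  rw [intervalIntegral.integral_sub (hE.const_mul _) hG,
    intervalIntegral.integral_const_mul] at hW
  have hGb : ‖∫ u in T..S, Complex.exp (-b * (u : ℂ) ^ 2) * (((u ^ 2)⁻¹ : ℝ) : ℂ)‖
      ≤ T⁻¹ - S⁻¹ := by
    rw [← hRint]
    apply intervalIntegral.norm_integral_le_of_norm_le hS _ hR
    filter_upwards with u hu
    rw [norm_mul, Complex.norm_real, Real.norm_of_nonneg (by positivity)]
    exact mul_le_of_le_one_left (by positivity) (hle1 u)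
  set J := ∫ u in T..S, Complex.exp (-b * (u : ℂ) ^ 2) with hJ
  set G := ∫ u in T..S, Complex.exp (-b * (u : ℂ) ^ 2) * (((u ^ 2)⁻¹ : ℝ) : ℂ) with hGdef
  have hb1 : ∀ u : ℝ, 0 < u → ‖Complex.exp (-b * (u : ℂ) ^ 2) * ((u⁻¹ : ℝ) : ℂ)‖ ≤ u⁻¹ := by
    intro u hu
    rw [norm_mul, Complex.norm_real, Real.norm_of_nonneg (by positivity)]
    exact mul_le_of_le_one_left (by positivity) (hle1 u)
  have hfin : 2 * b * J = Complex.exp (-b * (T : ℂ) ^ 2) * ((T⁻¹ : ℝ) : ℂ)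
      - Complex.exp (-b * (S : ℂ) ^ 2) * ((S⁻¹ : ℝ) : ℂ) - G := by
    linear_combination -hW
  have hn : ‖2 * b * J‖ ≤ T⁻¹ + S⁻¹ + (T⁻¹ - S⁻¹) := by
    rw [hfin]
    exact (norm_sub_le _ _).trans (add_le_add
      ((norm_sub_le _ _).trans (add_le_add (hb1 T hT) (hb1 S hS0))) hGb)
  have hbn : 0 < ‖b‖ := norm_pos_iff.mpr hb0
  rw [norm_mul, norm_mul, Complex.norm_ofNat] at hn
  rw [le_div_iff₀ (by positivity)]
  have h3 : ‖b‖ * ‖J‖ ≤ T⁻¹ := by linarith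
  calc ‖J‖ * (‖b‖ * T) = (‖b‖ * ‖J‖) * T := by ring
    _ ≤ T⁻¹ * T := by gcongr
    _ = 1 := inv_mul_cancel₀ hT.ne'

open Set Topology in
lemma fres_half_bound {b : ℂ} (hb : 0 < b.re) {T : ℝ} (hT : 0 < T) :
    ‖((Real.pi : ℂ) / b) ^ (1 / 2 : ℂ) / 2 - ∫ u in (0 : ℝ)..T, Complex.exp (-b * (u : ℂ) ^ 2)‖
      ≤ 1 / (‖b‖ * T) := by
  have hb0 : b ≠ 0 := by rintro rfl; simp at hb
  have hint := integrable_cexp_neg_mul_sq hb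
  have h := intervalIntegral_tendsto_integral_Ioi (0 : ℝ) hint.integrableOn tendsto_id
  rw [integral_gaussian_complex_Ioi hb] at h
  refine le_of_tendsto ((h.sub_const (∫ u in (0 : ℝ)..T, Complex.exp (-b * (u : ℂ) ^ 2))).norm) ?_
  filter_upwards [eventually_ge_atTop T] with S hS
  rw [id, intervalIntegral.integral_interval_sub_left hint.intervalIntegrable
    hint.intervalIntegrable]
  exact fres_tail_bound hb.le hb0 hT hS

open Set Topology in
lemma fres_half_bound_I {A : ℝ} (hA : 0 < A) {T : ℝ} (hT : 0 < T) :
    ‖((Real.pi : ℂ) / (I * (A : ℂ))) ^ (1 / 2 : ℂ) / 2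
        - ∫ u in (0 : ℝ)..T, Complex.exp (-(I * (A : ℂ)) * (u : ℂ) ^ 2)‖
      ≤ 1 / (A * T) := by
  have hA0 : (A : ℂ) ≠ 0 := by exact_mod_cast hA.ne'
  have hb0 : I * (A : ℂ) ≠ 0 := mul_ne_zero I_ne_zero hA0
  let β : ℝ → ℂ := fun ε => (ε : ℂ) + I * (A : ℂ)
  have hβ : Tendsto β (𝓝[>] 0) (𝓝 (I * (A : ℂ))) := by
    have : Continuous β := by fun_prop
    have h := this.tendsto 0
    simp only [β, ofReal_zero, zero_add] at h
    exact h.mono_left nhdsWithin_le_nhds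
  have hc1 : ContinuousAt (fun b : ℂ => ((Real.pi : ℂ) / b) ^ (1 / 2 : ℂ) / 2) (I * (A : ℂ)) := by
    apply ContinuousAt.div_const
    refine ContinuousAt.comp (g := fun w : ℂ => w ^ (1 / 2 : ℂ))
      (continuousAt_cpow_const (Or.inr ?_)) (continuousAt_const.div continuousAt_id hb0)
    simp [Complex.div_im, hA.ne', Real.pi_ne_zero]
  have hc2 : Continuous (fun b : ℂ => ∫ u in (0 : ℝ)..T, Complex.exp (-b * (u : ℂ) ^ 2)) := by
    apply intervalIntegral.continuous_parametric_intervalIntegral_of_continuous'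
    unfold Function.uncurry
    fun_prop
  have hc3 : ContinuousAt (fun b : ℂ => 1 / (‖b‖ * T)) (I * (A : ℂ)) := by
    apply ContinuousAt.div continuousAt_const (by fun_prop)
    have := norm_pos_iff.mpr hb0
    positivity
  have key := le_of_tendsto_of_tendsto
    (((hc1.sub hc2.continuousAt).norm).tendsto.comp hβ) (hc3.tendsto.comp hβ) (by
      filter_upwards [self_mem_nhdsWithin] with ε hε
      exact fres_half_bound (by simpa [β] using hε) hT)
  simpa [abs_of_pos hA] using key

open Set Topology in
lemma fres_tendsto {A : ℝ} (hA : 0 < A) :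
    Tendsto (fun T : ℝ => ∫ u in (0 : ℝ)..T, Complex.exp (-(I * (A : ℂ)) * (u : ℂ) ^ 2)) atTop
      (𝓝 (((Real.pi : ℂ) / (I * (A : ℂ))) ^ (1 / 2 : ℂ) / 2)) := by
  rw [tendsto_iff_norm_sub_tendsto_zero]
  have h0 : Tendsto (fun T : ℝ => 1 / (A * T)) atTop (𝓝 0) := by
    have := (tendsto_id.const_mul_atTop hA).inv_tendsto_atTop
    refine this.congr fun T => ?_
    simp [one_div]
  refine squeeze_zero' (Eventually.of_forall fun _ => norm_nonneg _) ?_ h0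
  filter_upwards [eventually_gt_atTop 0] with T hT
  rw [norm_sub_rev]
  exact fres_half_bound_I hA hT

lemma fres_erf {A : ℝ} (hA : 0 < A) (y : ℝ) :
    ((Real.pi : ℂ) / (I * (A : ℂ))) ^ (1 / 2 : ℂ) / 2
        * cErf ((I * (A : ℂ)) ^ (1 / 2 : ℂ) * (y : ℂ))
      = ∫ u in (0 : ℝ)..y, Complex.exp (-(I * (A : ℂ)) * (u : ℂ) ^ 2) := by
  have hA0 : (A : ℂ) ≠ 0 := by exact_mod_cast hA.ne'
  have hb0 : I * (A : ℂ) ≠ 0 := mul_ne_zero I_ne_zero hA0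
  set s := (I * (A : ℂ)) ^ (1 / 2 : ℂ) with hs
  have hs2 : s ^ 2 = I * (A : ℂ) := by
    rw [hs, one_div]; exact cpow_ofNat_inv_pow _ 2
  have hs0 : s ≠ 0 := by
    intro h; rw [h] at hs2; exact hb0 (by rw [← hs2]; simp)
  have hsp : (Real.sqrt Real.pi : ℂ) ≠ 0 := by
    exact_mod_cast (Real.sqrt_pos.mpr Real.pi_pos).ne'
  have hroot : ((Real.pi : ℂ) / (I * (A : ℂ))) ^ (1 / 2 : ℂ) = (Real.sqrt Real.pi : ℂ) / s := by
    have harg : (I * (A : ℂ)).arg ≠ Real.pi := by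
      rw [mul_comm, Complex.arg_real_mul _ hA, Complex.arg_I]
      linarith [Real.pi_pos]
    have hpi : (Real.pi : ℂ) ^ (1 / 2 : ℂ) = (Real.sqrt Real.pi : ℂ) := by
      rw [Real.sqrt_eq_rpow, Complex.ofReal_cpow Real.pi_pos.le]
      norm_num
    have hpi0 : (Real.pi : ℂ) ≠ 0 := by exact_mod_cast Real.pi_ne_zero
    rw [div_eq_mul_inv, cpow_def_of_ne_zero (mul_ne_zero hpi0 (inv_ne_zero hb0)),
      Complex.log_ofReal_mul Real.pi_pos (inv_ne_zero hb0), add_mul, Complex.exp_add,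
      Complex.ofReal_log Real.pi_pos.le, ← cpow_def_of_ne_zero hpi0,
      ← cpow_def_of_ne_zero (inv_ne_zero hb0), inv_cpow _ _ harg, hpi, ← hs, div_eq_mul_inv]
  have hsub := intervalIntegral.smul_integral_comp_mul_left
    (fun u : ℝ => Complex.exp (-(I * (A : ℂ)) * (u : ℂ) ^ 2)) y (a := 0) (b := 1)
  rw [mul_zero, mul_one] at hsub
  rw [← hsub, hroot, cErf, intervalIntegral.integral_const_mul]
  have hcongr : (∫ t in (0:ℝ)..1, Complex.exp (-((t : ℂ) * (s * (y : ℂ))) ^ 2))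
      = ∫ t in (0:ℝ)..1, Complex.exp (-(I * (A : ℂ)) * ((y * t : ℝ) : ℂ) ^ 2) := by
    congr 1; funext t; congr 1
    rw [← hs2]; push_cast; ring
  rw [hcongr, Complex.real_smul]
  push_cast
  field_simp

/-- Semi-infinite knife-edge case of Proposition 1 (upper edge at `+∞`):
with `A = k0·z/(2·z_b·(z − z_b))` and `μ = (z_b·x + (z − z_b)·ν)/z`,
`∫_{−R}^{x1} exp(−i·k0·(ξ−ν)²/(2·z_b))·exp(−i·k0·(x−ξ)²/(2·(z−z_b))) dξ`
converges, as `R → ∞`, to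
`(1/2)·√(π/(i·A))·exp(−i·k0·(ν−x)²/(2·z))·[1 + Erf(√(i·A)·(x1−μ))]`. -/
theorem knife_edge_kernel_semiInfinite
    (k0 z zb x ν x1 : ℝ) (hk0 : 0 < k0) (hzb : 0 < zb) (hz : zb < z) :
    Tendsto (fun R : ℝ => ∫ ξ in (-R)..x1,
        Complex.exp (-Complex.I * (k0 : ℂ) * ((ξ : ℂ) - (ν : ℂ)) ^ 2 / (2 * (zb : ℂ)))
          * Complex.exp (-Complex.I * (k0 : ℂ) * ((x : ℂ) - (ξ : ℂ)) ^ 2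
              / (2 * ((z : ℂ) - (zb : ℂ))))) atTop
      (nhds ((1 / 2 : ℂ)
        * ((Real.pi : ℂ) / (Complex.I * ((k0 * z / (2 * zb * (z - zb)) : ℝ) : ℂ))) ^ (1 / 2 : ℂ)
        * Complex.exp (-Complex.I * (k0 : ℂ) * ((ν : ℂ) - (x : ℂ)) ^ 2 / (2 * (z : ℂ)))
        * (1 + cErf ((Complex.I * ((k0 * z / (2 * zb * (z - zb)) : ℝ) : ℂ)) ^ (1 / 2 : ℂ)
            * (((x1 : ℝ) : ℂ) - (((zb * x + (z - zb) * ν) / z : ℝ) : ℂ)))))) := by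
  have hz0 : 0 < z := hzb.trans hz
  have hd : 0 < z - zb := sub_pos.mpr hz
  have hA : 0 < k0 * z / (2 * zb * (z - zb)) := by positivity
  have hzc : (z : ℂ) ≠ 0 := by exact_mod_cast hz0.ne'
  have hzbc : (zb : ℂ) ≠ 0 := by exact_mod_cast hzb.ne'
  have hdc : (z : ℂ) - (zb : ℂ) ≠ 0 := by exact_mod_cast hd.ne'
  have hAc : ((k0 * z / (2 * zb * (z - zb)) : ℝ) : ℂ)
      = (k0 : ℂ) * z / (2 * zb * ((z : ℂ) - zb)) := by push_cast; ring
  have hμc : (((zb * x + (z - zb) * ν) / z : ℝ) : ℂ)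
      = ((zb : ℂ) * x + ((z : ℂ) - zb) * ν) / z := by push_cast; ring
  set A : ℝ := k0 * z / (2 * zb * (z - zb)) with hAdef
  set μ : ℝ := (zb * x + (z - zb) * ν) / z with hμdef
  set C : ℂ := Complex.exp (-Complex.I * (k0 : ℂ) * ((ν : ℂ) - (x : ℂ)) ^ 2 / (2 * (z : ℂ)))
    with hC
  let f : ℝ → ℂ := fun u => Complex.exp (-(I * (A : ℂ)) * (u : ℂ) ^ 2)
  have hfc : Continuous f := by fun_prop
  have hfi : ∀ a b : ℝ, IntervalIntegrable f volume a b := fun a b => hfc.intervalIntegrable a b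
  have hfun : (fun R : ℝ => ∫ ξ in (-R)..x1,
        Complex.exp (-Complex.I * (k0 : ℂ) * ((ξ : ℂ) - (ν : ℂ)) ^ 2 / (2 * (zb : ℂ)))
          * Complex.exp (-Complex.I * (k0 : ℂ) * ((x : ℂ) - (ξ : ℂ)) ^ 2
              / (2 * ((z : ℂ) - (zb : ℂ)))))
      = fun R : ℝ => C * ((∫ u in (0 : ℝ)..(R + μ), f u) + ∫ u in (0 : ℝ)..(x1 - μ), f u) := by
    funext R
    have h1 : ∀ ξ : ℝ,
        Complex.exp (-Complex.I * (k0 : ℂ) * ((ξ : ℂ) - (ν : ℂ)) ^ 2 / (2 * (zb : ℂ)))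
          * Complex.exp (-Complex.I * (k0 : ℂ) * ((x : ℂ) - (ξ : ℂ)) ^ 2
              / (2 * ((z : ℂ) - (zb : ℂ)))) = C * f (ξ - μ) := by
      intro ξ
      simp only [f, hC]
      rw [← Complex.exp_add, ← Complex.exp_add]
      congr 1
      rw [Complex.ofReal_sub, hAc, hμc]
      field_simp
      ring
    simp_rw [h1]
    rw [intervalIntegral.integral_const_mul, intervalIntegral.integral_comp_sub_right f μ,
      ← intervalIntegral.integral_add_adjacent_intervals (hfi (-R - μ) 0) (hfi 0 (x1 - μ))]
    congr 2
    have h2 := intervalIntegral.integral_comp_neg (a := 0) (b := R + μ) f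
    have h3 : ∀ u, f (-u) = f u := by intro u; simp [f]
    simp_rw [h3] at h2
    rw [h2, neg_zero]
    congr 1
    ring
  rw [hfun]
  have hlim := ((fres_tendsto hA).comp
    (tendsto_atTop_add_const_right atTop μ tendsto_id)).add_const (∫ u in (0 : ℝ)..(x1 - μ), f u)
  have hlim2 := hlim.const_mul C
  refine (congrArg (fun L => Tendsto _ atTop (nhds L)) ?_).mpr hlim2
  have he := fres_erf hA (x1 - μ)
  rw [Complex.ofReal_sub] at he
  simp only [f]
  rw [← he]
  ring
end

section
/- Let a > 0 and b > 0 be real numbers and let x, ν ∈ ℝ. Then, as R → ∞, ∫_{−R}^{R} exp(−i·a·(ξ − ν)²)·exp(−i·b·(x − ξ)²) dξ converges to √(π/(i·(a + b))) · exp(−i·(a·b/(a + b))·(x − ν)²). -/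
open MeasureTheory intervalIntegral Filter Complex

lemma fresnel_tail (β : ℂ) (hβ : 0 ≤ β.re) (c : ℝ) (hc : 0 < c) (hcβ : c ≤ ‖β‖) (R S : ℝ)
    (hR : 0 < R) (hRS : R ≤ S) :
    ‖∫ t in R..S, Complex.exp (-β * (t : ℂ) ^ 2)‖ ≤ 1 / (c * R) := by
  have hS : 0 < S := lt_of_lt_of_le hR hRS
  have hβ0 : β ≠ 0 := by
    rintro rfl
    simp at hcβ
    linarith
  have hE : ∀ t : ℝ, ‖Complex.exp (-β * (t : ℂ) ^ 2)‖ ≤ 1 := by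
    intro t
    rw [norm_cexp_neg_mul_sq]
    apply Real.exp_le_one_iff.2
    nlinarith [mul_nonneg hβ (sq_nonneg t)]
  have hpos : ∀ t ∈ Set.uIcc R S, 0 < t := by
    intro t ht
    rw [Set.uIcc_of_le hRS] at ht
    exact lt_of_lt_of_le hR ht.1
  have hcont : Continuous (fun t : ℝ => Complex.exp (-β * (t : ℂ) ^ 2)) := by fun_prop
  have hcont2 : ContinuousOn (fun t : ℝ => Complex.exp (-β * (t : ℂ) ^ 2) / (2 * β * (t : ℂ) ^ 2))
      (Set.uIcc R S) := by
    apply ContinuousOn.div hcont.continuousOn (by fun_prop)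
    intro t ht
    have : (t : ℂ) ≠ 0 := by exact_mod_cast (hpos t ht).ne'
    simp [hβ0, this]
  have hF : ∀ t ∈ Set.uIcc R S, HasDerivAt
      (fun t : ℝ => -(Complex.exp (-β * (t : ℂ) ^ 2) / (2 * β * (t : ℂ))))
      (Complex.exp (-β * (t : ℂ) ^ 2) +
        Complex.exp (-β * (t : ℂ) ^ 2) / (2 * β * (t : ℂ) ^ 2)) t := by
    intro t ht
    have ht0 : (t : ℂ) ≠ 0 := by exact_mod_cast (hpos t ht).ne'
    have h0 : HasDerivAt (fun t : ℝ => (t : ℂ)) 1 t := Complex.ofRealCLM.hasDerivAt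
    have h1 := ((h0.pow 2).const_mul (-β)).cexp
    have h2 := (h1.div (h0.const_mul (2 * β)) (by simp [hβ0, ht0])).neg
    refine h2.congr_deriv ?_
    simp
    field_simp
    ring
  have hint := integral_eq_sub_of_hasDerivAt hF
    ((hcont.intervalIntegrable _ _).add hcont2.intervalIntegrable)
  rw [intervalIntegral.integral_add (hcont.intervalIntegrable _ _) hcont2.intervalIntegrable]
    at hint
  have hB : ∀ t ∈ Set.uIcc R S, HasDerivAt (fun t : ℝ => -(1 / (2 * c)) * t⁻¹)
      (1 / (2 * c * t ^ 2)) t := by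
    intro t ht
    have ht0 := (hpos t ht).ne'
    refine ((hasDerivAt_inv ht0).const_mul (-(1 / (2 * c)))).congr_deriv ?_
    field_simp
  have hBc : ContinuousOn (fun t : ℝ => 1 / (2 * c * t ^ 2)) (Set.uIcc R S) := by
    apply ContinuousOn.div (by fun_prop) (by fun_prop)
    intro t ht
    have := hpos t ht
    positivity
  have hBint := integral_eq_sub_of_hasDerivAt hB hBc.intervalIntegrable
  have h2 : ‖∫ t in R..S, Complex.exp (-β * (t : ℂ) ^ 2) / (2 * β * (t : ℂ) ^ 2)‖ ≤
      ∫ t in R..S, 1 / (2 * c * t ^ 2) := by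
    apply intervalIntegral.norm_integral_le_of_norm_le hRS _ hBc.intervalIntegrable
    refine Eventually.of_forall fun t ht => ?_
    have ht0 : 0 < t := lt_trans hR ht.1
    rw [norm_div]
    simp only [norm_mul, norm_pow, Complex.norm_real, Real.norm_eq_abs, abs_of_pos ht0,
      Complex.norm_ofNat]
    gcongr
    exact hE t
  have h3 : ∀ t : ℝ, 0 < t → ‖-(Complex.exp (-β * (t : ℂ) ^ 2) / (2 * β * (t : ℂ)))‖ ≤
      1 / (2 * c) * t⁻¹ := by
    intro t ht0
    rw [norm_neg, norm_div]
    simp only [norm_mul, Complex.norm_real, Real.norm_eq_abs, abs_of_pos ht0,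
      Complex.norm_ofNat]
    rw [← div_eq_mul_inv, div_div]
    gcongr
    exact hE t
  rw [hBint] at h2
  rw [eq_sub_of_add_eq hint]
  refine (norm_sub_le _ _).trans ?_
  refine (add_le_add (norm_sub_le _ _) h2).trans ?_
  have e : 1 / (c * R) = 1 / (2 * c) * R⁻¹ + 1 / (2 * c) * R⁻¹ := by field_simp; norm_num
  have := h3 R hR
  have := h3 S hS
  linarith

lemma fresnel_half_bound (c : ℝ) (hc : 0 < c) (R : ℝ) (hR : 0 < R) :
    ‖((Real.pi : ℂ) / (I * c)) ^ (1 / 2 : ℂ) / 2 -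
      ∫ t in (0 : ℝ)..R, Complex.exp (-(I * c) * (t : ℂ) ^ 2)‖ ≤ 1 / (c * R) := by
  have key : ∀ ε : ℝ, 0 < ε → ‖((Real.pi : ℂ) / (ε + I * c)) ^ (1 / 2 : ℂ) / 2 -
      ∫ t in (0 : ℝ)..R, Complex.exp (-(ε + I * c) * (t : ℂ) ^ 2)‖ ≤ 1 / (c * R) := by
    intro ε hε
    have hre : 0 < ((ε : ℂ) + I * c).re := by simpa using hε
    have hn : c ≤ ‖(ε : ℂ) + I * c‖ := by
      have := Complex.abs_im_le_norm ((ε : ℂ) + I * c)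
      simp [abs_of_pos hc] at this
      exact this
    have hlim := intervalIntegral_tendsto_integral_Ioi 0
      (integrable_cexp_neg_mul_sq hre).integrableOn tendsto_id
    rw [integral_gaussian_complex_Ioi hre] at hlim
    refine le_of_tendsto (hlim.sub_const _).norm ?_
    filter_upwards [eventually_ge_atTop R] with S hS
    have hcont : Continuous (fun t : ℝ => Complex.exp (-((ε : ℂ) + I * c) * (t : ℂ) ^ 2)) := by
      fun_prop
    rw [id, intervalIntegral.integral_interval_sub_left (hcont.intervalIntegrable _ _)
      (hcont.intervalIntegrable _ _)]
    exact fresnel_tail _ hre.le c hc hn R S hR hS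
  have hc0 : (c : ℂ) ≠ 0 := by exact_mod_cast hc.ne'
  have h1 : ContinuousAt (fun ε : ℝ => ((Real.pi : ℂ) / (ε + I * c)) ^ (1 / 2 : ℂ) / 2) 0 := by
    apply ContinuousAt.div_const
    apply ContinuousAt.cpow _ continuousAt_const
    · right
      simp [Complex.div_im, Complex.normSq_apply, Real.pi_ne_zero, hc.ne']
    · apply ContinuousAt.div continuousAt_const (by fun_prop)
      simp [hc0]
  have h2 : Continuous (fun ε : ℝ =>
      ∫ t in (0 : ℝ)..R, Complex.exp (-(ε + I * c) * (t : ℂ) ^ 2)) := by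
    apply intervalIntegral.continuous_parametric_intervalIntegral_of_continuous'
    simp only [Function.uncurry_def]
    fun_prop
  have h3 := (h1.sub h2.continuousAt).norm
  have h4 : Tendsto _ (nhdsWithin (0 : ℝ) (Set.Ioi 0)) _ := h3.tendsto.mono_left nhdsWithin_le_nhds
  have h5 := le_of_tendsto h4 (b := 1 / (c * R)) (by
    filter_upwards [self_mem_nhdsWithin] with ε hε
    exact key ε hε)
  simpa using h5

lemma fresnel_half (c : ℝ) (hc : 0 < c) :
    Tendsto (fun R : ℝ => ∫ t in (0 : ℝ)..R, Complex.exp (-(I * c) * (t : ℂ) ^ 2)) atTop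
      (nhds (((Real.pi : ℂ) / (I * c)) ^ (1 / 2 : ℂ) / 2)) := by
  rw [tendsto_iff_norm_sub_tendsto_zero]
  have hl : Tendsto (fun R : ℝ => 1 / (c * R)) atTop (nhds 0) := by
    simp only [one_div]
    exact (tendsto_id.const_mul_atTop hc).inv_tendsto_atTop
  refine squeeze_zero' (Eventually.of_forall fun _ => norm_nonneg _) ?_ hl
  filter_upwards [eventually_gt_atTop 0] with R hR
  rw [norm_sub_rev]
  exact fresnel_half_bound c hc R hR

/-- Semigroup property of the Fresnel propagation kernel (unobstructed case):
for `a, b > 0`, the symmetric truncation `∫_{−R}^{R} exp(−i·a·(ξ−ν)²)·exp(−i·b·(x−ξ)²) dξ`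
converges, as `R → ∞`, to `√(π/(i·(a+b)))·exp(−i·(a·b/(a+b))·(x−ν)²)`. -/
theorem fresnel_kernel_semigroup (a b : ℝ) (ha : 0 < a) (hb : 0 < b) (x ν : ℝ) :
    Tendsto (fun R : ℝ => ∫ ξ in (-R)..R,
        Complex.exp (-Complex.I * (a : ℂ) * ((ξ : ℂ) - (ν : ℂ)) ^ 2)
          * Complex.exp (-Complex.I * (b : ℂ) * ((x : ℂ) - (ξ : ℂ)) ^ 2)) atTop
      (nhds (((Real.pi : ℂ) / (Complex.I * ((a : ℂ) + (b : ℂ)))) ^ (1 / 2 : ℂ)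
        * Complex.exp (-Complex.I * ((a : ℂ) * (b : ℂ) / ((a : ℂ) + (b : ℂ)))
            * ((x : ℂ) - (ν : ℂ)) ^ 2))) := by
  have hc : 0 < a + b := by linarith
  have hc0 : (a : ℂ) + b ≠ 0 := by exact_mod_cast hc.ne'
  obtain ⟨m, hm⟩ : ∃ m : ℝ, m = (a * ν + b * x) / (a + b) := ⟨_, rfl⟩
  have hmc : (m : ℂ) = (a * ν + b * x) / (a + b) := by rw [hm]; push_cast; rfl
  have hhalf := fresnel_half (a + b) hc
  have t1 : Tendsto (fun R : ℝ => R - m) atTop atTop := tendsto_atTop_add_const_right _ (-m) tendsto_id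
  have t2 : Tendsto (fun R : ℝ => R + m) atTop atTop := tendsto_atTop_add_const_right _ m tendsto_id
  have hsum := ((hhalf.comp t1).add (hhalf.comp t2)).mul_const
    (Complex.exp (-Complex.I * ((a : ℂ) * (b : ℂ) / ((a : ℂ) + (b : ℂ)))
            * ((x : ℂ) - (ν : ℂ)) ^ 2))
  rw [add_halves] at hsum
  push_cast at hsum
  refine hsum.congr fun R => ?_
  have hcont : Continuous (fun t : ℝ => Complex.exp (-(I * ((a : ℂ) + b)) * (t : ℂ) ^ 2)) := by
    fun_prop
  have e1 : ∀ ξ : ℝ, Complex.exp (-Complex.I * (a : ℂ) * ((ξ : ℂ) - (ν : ℂ)) ^ 2)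
          * Complex.exp (-Complex.I * (b : ℂ) * ((x : ℂ) - (ξ : ℂ)) ^ 2) =
      Complex.exp (-(I * ((a : ℂ) + b)) * ((ξ - m : ℝ) : ℂ) ^ 2) *
      Complex.exp (-Complex.I * ((a : ℂ) * (b : ℂ) / ((a : ℂ) + (b : ℂ)))
            * ((x : ℂ) - (ν : ℂ)) ^ 2) := by
    intro ξ
    rw [← Complex.exp_add, ← Complex.exp_add]
    congr 1
    push_cast
    rw [hmc]
    field_simp
    ring
  simp_rw [e1]
  rw [intervalIntegral.integral_mul_const]
  congr 1
  rw [intervalIntegral.integral_comp_sub_right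
    (fun t : ℝ => Complex.exp (-(I * ((a : ℂ) + b)) * (t : ℂ) ^ 2)) m]
  have e2 := intervalIntegral.integral_comp_neg (a := 0) (b := R + m)
    (fun t : ℝ => Complex.exp (-(I * ((a : ℂ) + b)) * (t : ℂ) ^ 2))
  simp only [Complex.ofReal_neg, neg_sq, neg_zero] at e2
  simp only [Function.comp]
  rw [e2, add_comm, show -R - m = -(R + m) by ring]
  exact intervalIntegral.integral_add_adjacent_intervals (hcont.intervalIntegrable _ _)
    (hcont.intervalIntegrable _ _)
end

section
/- Let A > 0 and let c, μ ∈ ℝ. Then, as R → ∞, ∫_{c}^{R} exp(−i·A·(ξ − μ)²) dξ converges to (1/2)·√(π/(i·A)) · Erfc(√(i·A)·(c − μ)). -/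
open MeasureTheory intervalIntegral Filter Complex

lemma fr_norm_exp_le {b : ℂ} (hb : 0 ≤ b.re) (x : ℝ) :
    ‖Complex.exp (-b * (x : ℂ) ^ 2)‖ ≤ 1 := by
  rw [norm_cexp_neg_mul_sq]
  apply Real.exp_le_one_iff.mpr
  nlinarith [mul_nonneg hb (sq_nonneg x)]

lemma fr_hasDeriv {b : ℂ} (hb0 : b ≠ 0) (x : ℝ) (hx : 0 < x) :
    HasDerivAt (fun y : ℝ => -Complex.exp (-b * (y : ℂ) ^ 2) / (2 * b * (y : ℂ)))
      (Complex.exp (-b * (x : ℂ) ^ 2)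
        + Complex.exp (-b * (x : ℂ) ^ 2) / (2 * b * (x : ℂ) ^ 2)) x := by
  have hxc : (x : ℂ) ≠ 0 := by exact_mod_cast hx.ne'
  have hid : HasDerivAt (fun y : ℝ => (y : ℂ)) 1 x := Complex.ofRealCLM.hasDerivAt
  have h1 := (((hid.pow 2).const_mul (-b)).cexp.neg).div (hid.const_mul (2 * b))
    (by simp [hb0, hxc])
  refine h1.congr_deriv ?_
  simp only [Pi.pow_apply, Pi.neg_apply]
  field_simp
  push_cast
  ring

lemma fr_tail {b : ℂ} (hb0 : b ≠ 0) (hb : 0 ≤ b.re) {R S : ℝ} (hR : 0 < R) (hRS : R ≤ S) :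
    ‖∫ x in R..S, Complex.exp (-b * (x : ℂ) ^ 2)‖ ≤ 1 / (‖b‖ * R) := by
  have hS : 0 < S := hR.trans_le hRS
  have hbn : 0 < ‖b‖ := norm_pos_iff.mpr hb0
  have hpos : ∀ x ∈ Set.uIcc R S, 0 < x := by
    intro x hx
    rw [Set.uIcc_of_le hRS] at hx
    exact hR.trans_le hx.1
  have hc1 : Continuous (fun x : ℝ => Complex.exp (-b * (x : ℂ) ^ 2)) := by fun_prop
  have hc2 : ContinuousOn (fun x : ℝ => Complex.exp (-b * (x : ℂ) ^ 2) / (2 * b * (x : ℂ) ^ 2))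
      (Set.uIcc R S) := by
    apply ContinuousOn.div (by fun_prop) (by fun_prop)
    intro x hx
    have : (x : ℂ) ≠ 0 := by exact_mod_cast (hpos x hx).ne'
    simp [hb0, this]
  have hi1 := hc1.intervalIntegrable (μ := volume) R S
  have hi2 := hc2.intervalIntegrable (μ := volume)
  have hF := integral_eq_sub_of_hasDerivAt (fun x hx => fr_hasDeriv hb0 x (hpos x hx))
    (hi1.add hi2)
  rw [intervalIntegral.integral_add hi1 hi2] at hF
  have hbd : ∀ y : ℝ, 0 < y →
      ‖-Complex.exp (-b * (y : ℂ) ^ 2) / (2 * b * (y : ℂ))‖ ≤ 1 / (2 * ‖b‖ * y) := by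
    intro y hy
    rw [norm_div, norm_neg, norm_mul, norm_mul, Complex.norm_real, Real.norm_of_nonneg hy.le]
    simp only [Complex.norm_ofNat]
    gcongr
    exact fr_norm_exp_le hb y
  have hcr : ContinuousOn (fun x : ℝ => 1 / (2 * ‖b‖ * x ^ 2)) (Set.uIcc R S) := by
    apply ContinuousOn.div (by fun_prop) (by fun_prop)
    intro x hx
    have := hpos x hx
    positivity
  have hr : ∫ x in R..S, 1 / (2 * ‖b‖ * x ^ 2) = -(1 / (2 * ‖b‖ * S)) - -(1 / (2 * ‖b‖ * R)) := by
    refine integral_eq_sub_of_hasDerivAt (f := fun x : ℝ => -(1 / (2 * ‖b‖ * x)))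
      (fun x hx => ?_) hcr.intervalIntegrable
    have hx0 := hpos x hx
    have h := ((hasDerivAt_const x (1:ℝ)).div ((hasDerivAt_id x).const_mul (2 * ‖b‖))
      (by simp only [id]; positivity)).neg
    refine h.congr_deriv ?_
    simp only [id]
    field_simp
    ring
  have h2 : ‖∫ x in R..S, Complex.exp (-b * (x : ℂ) ^ 2) / (2 * b * (x : ℂ) ^ 2)‖
      ≤ ∫ x in R..S, 1 / (2 * ‖b‖ * x ^ 2) := by
    refine norm_integral_le_of_norm_le hRS ?_ hcr.intervalIntegrable
    refine Eventually.of_forall fun x hx => ?_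
    have hx0 : 0 < x := hR.trans hx.1
    rw [norm_div, norm_mul, norm_mul, norm_pow, Complex.norm_real, Real.norm_of_nonneg hx0.le]
    simp only [Complex.norm_ofNat]
    gcongr
    exact fr_norm_exp_le hb x
  have hS1 := hbd S hS
  have hR1 := hbd R hR
  rw [eq_sub_of_add_eq hF]
  refine (norm_sub_le _ _).trans ?_
  have h3 := norm_sub_le (-Complex.exp (-b * (S : ℂ) ^ 2) / (2 * b * (S : ℂ)))
    (-Complex.exp (-b * (R : ℂ) ^ 2) / (2 * b * (R : ℂ)))
  have h4 : 1 / (‖b‖ * R) = 1 / (2 * ‖b‖ * R) + 1 / (2 * ‖b‖ * R) := by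
    field_simp; norm_num
  rw [hr] at h2
  linarith

lemma fr_pos {b : ℂ} (hb : 0 < b.re) {R : ℝ} (hR : 0 < R) :
    ‖((Real.pi : ℂ) / b) ^ (1 / 2 : ℂ) / 2 - ∫ x in (0:ℝ)..R, Complex.exp (-b * (x : ℂ) ^ 2)‖
      ≤ 1 / (‖b‖ * R) := by
  have hb0 : b ≠ 0 := by rintro rfl; simp at hb
  have hc : Continuous (fun x : ℝ => Complex.exp (-b * (x : ℂ) ^ 2)) := by fun_prop
  have ht := intervalIntegral_tendsto_integral_Ioi 0
    (integrable_cexp_neg_mul_sq hb).integrableOn tendsto_id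
  rw [integral_gaussian_complex_Ioi hb] at ht
  refine le_of_tendsto (ht.sub_const _).norm ?_
  filter_upwards [eventually_ge_atTop R] with S hS
  rw [id, integral_interval_sub_left (hc.intervalIntegrable _ _) (hc.intervalIntegrable _ _)]
  exact fr_tail hb0 hb.le hR hS

lemma fr_imag {A : ℝ} (hA : 0 < A) {R : ℝ} (hR : 0 < R) :
    ‖((Real.pi : ℂ) / (I * A)) ^ (1 / 2 : ℂ) / 2
      - ∫ x in (0:ℝ)..R, Complex.exp (-(I * A) * (x : ℂ) ^ 2)‖ ≤ 1 / (A * R) := by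
  have hAc : (A : ℂ) ≠ 0 := by exact_mod_cast hA.ne'
  have hb0 : I * (A : ℂ) ≠ 0 := mul_ne_zero I_ne_zero hAc
  have hci : Continuous (fun b : ℂ => ∫ x in (0:ℝ)..R, Complex.exp (-b * (x : ℂ) ^ 2)) := by
    apply continuous_parametric_intervalIntegral_of_continuous'
    fun_prop
  have hsl : (Real.pi : ℂ) / (I * A) ∈ slitPlane := by
    rw [mem_slitPlane_iff]
    right
    have : (Real.pi : ℂ) / (I * A) = ((-(Real.pi / A) : ℝ) : ℂ) * I := by
      push_cast
      field_simp
      simp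
    rw [this, Complex.im_ofReal_mul]
    simp [hA.ne', Real.pi_ne_zero]
  have hcp : ContinuousAt (fun b : ℂ => ((Real.pi : ℂ) / b) ^ (1 / 2 : ℂ)) (I * A) :=
    (continuousAt_const.div continuousAt_id hb0).cpow continuousAt_const hsl
  have hG : ContinuousAt (fun b : ℂ => ‖((Real.pi : ℂ) / b) ^ (1 / 2 : ℂ) / 2
      - ∫ x in (0:ℝ)..R, Complex.exp (-b * (x : ℂ) ^ 2)‖) (I * A) :=
    ((hcp.div_const 2).sub hci.continuousAt).norm
  have hH : ContinuousAt (fun b : ℂ => 1 / (‖b‖ * R)) (I * A) := by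
    apply ContinuousAt.div (by fun_prop) (by fun_prop)
    have : 0 < ‖I * (A : ℂ)‖ := norm_pos_iff.mpr hb0
    positivity
  have he : Tendsto (fun e : ℝ => (e : ℂ) + I * A) (nhdsWithin 0 (Set.Ioi 0)) (nhds (I * A)) := by
    have : Continuous (fun e : ℝ => (e : ℂ) + I * A) := by fun_prop
    have h := this.tendsto 0
    simp only [Complex.ofReal_zero, zero_add] at h
    exact h.mono_left nhdsWithin_le_nhds
  have hfin := le_of_tendsto_of_tendsto (hG.tendsto.comp he) (hH.tendsto.comp he) (by
    filter_upwards [self_mem_nhdsWithin] with e hepos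
    have : 0 < ((e : ℂ) + I * A).re := by simpa using hepos
    exact fr_pos this hR)
  simpa [abs_of_pos hA] using hfin

lemma fr_tendsto {A : ℝ} (hA : 0 < A) :
    Tendsto (fun R : ℝ => ∫ x in (0:ℝ)..R, Complex.exp (-(I * A) * (x : ℂ) ^ 2)) atTop
      (nhds (((Real.pi : ℂ) / (I * A)) ^ (1 / 2 : ℂ) / 2)) := by
  rw [tendsto_iff_norm_sub_tendsto_zero]
  have h0 : Tendsto (fun R : ℝ => 1 / (A * R)) atTop (nhds 0) :=
    tendsto_const_nhds.div_atTop (tendsto_id.const_mul_atTop hA)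
  refine squeeze_zero' (Eventually.of_forall fun _ => norm_nonneg _) ?_ h0
  filter_upwards [eventually_gt_atTop 0] with R hR
  rw [norm_sub_rev]
  exact fr_imag hA hR

lemma fr_sqrt {A : ℝ} (hA : 0 < A) :
    ((Real.pi : ℂ) / (I * A)) ^ (1 / 2 : ℂ) * (I * (A : ℂ)) ^ (1 / 2 : ℂ)
      = (Real.sqrt Real.pi : ℝ) := by
  have hAc : (A : ℂ) ≠ 0 := by exact_mod_cast hA.ne'
  have hb0 : I * (A : ℂ) ≠ 0 := mul_ne_zero I_ne_zero hAc
  have harg : (I * (A : ℂ)).arg ≠ Real.pi := by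
    rw [mul_comm, Complex.arg_real_mul _ hA, Complex.arg_I]
    linarith [Real.pi_pos]
  have hpc : (Real.pi : ℂ) ≠ 0 := by exact_mod_cast Real.pi_ne_zero
  have hinv : (I * (A : ℂ))⁻¹ ≠ 0 := inv_ne_zero hb0
  rw [div_eq_mul_inv, Complex.cpow_def_of_ne_zero (mul_ne_zero hpc hinv),
    Complex.cpow_def_of_ne_zero hb0, Complex.log_ofReal_mul Real.pi_pos hinv,
    Complex.log_inv _ harg, ← Complex.exp_add, Real.sqrt_eq_rpow,
    Complex.ofReal_cpow Real.pi_pos.le, Complex.cpow_def_of_ne_zero hpc,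
    ← Complex.ofReal_log Real.pi_pos.le]
  congr 1
  push_cast
  ring

/-- Half-line Fresnel-type Gaussian integral with purely imaginary quadratic
coefficient: for `A > 0`, `∫_c^R exp(−i·A·(ξ−μ)²) dξ` converges, as `R → ∞`,
to `(1/2)·√(π/(i·A))·Erfc(√(i·A)·(c−μ))`. -/
theorem fresnel_halfline_erfc (A : ℝ) (hA : 0 < A) (c μ : ℝ) :
    Tendsto (fun R : ℝ => ∫ ξ in c..R,
        Complex.exp (-Complex.I * (A : ℂ) * ((ξ : ℂ) - (μ : ℂ)) ^ 2)) atTop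
      (nhds ((1 / 2 : ℂ) * ((Real.pi : ℂ) / (Complex.I * (A : ℂ))) ^ (1 / 2 : ℂ)
        * cErfc ((Complex.I * (A : ℂ)) ^ (1 / 2 : ℂ) * ((c : ℂ) - (μ : ℂ))))) := by
  set s : ℂ := (I * (A : ℂ)) ^ (1 / 2 : ℂ) with hs
  set P : ℂ := ((Real.pi : ℂ) / (I * (A : ℂ))) ^ (1 / 2 : ℂ) with hP
  have hs2 : s ^ 2 = I * A := by
    rw [hs, one_div]
    exact_mod_cast Complex.cpow_nat_inv_pow (I * (A : ℂ)) (n := 2) two_ne_zero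
  have hPs : P * s = (Real.sqrt Real.pi : ℝ) := fr_sqrt hA
  have hpi : ((Real.sqrt Real.pi : ℝ) : ℂ) ≠ 0 := by
    exact_mod_cast (Real.sqrt_pos.mpr Real.pi_pos).ne'
  have hc : Continuous (fun x : ℝ => Complex.exp (-(I * A) * (x : ℂ) ^ 2)) := by fun_prop
  have h1 : ∀ R : ℝ, ∫ ξ in c..R, Complex.exp (-I * (A : ℂ) * ((ξ : ℂ) - (μ : ℂ)) ^ 2)
      = (∫ x in (0:ℝ)..(R - μ), Complex.exp (-(I * A) * (x : ℂ) ^ 2))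
        - ∫ x in (0:ℝ)..(c - μ), Complex.exp (-(I * A) * (x : ℂ) ^ 2) := by
    intro R
    rw [integral_interval_sub_left (hc.intervalIntegrable _ _) (hc.intervalIntegrable _ _),
      ← intervalIntegral.integral_comp_sub_right
        (fun x : ℝ => Complex.exp (-(I * A) * (x : ℂ) ^ 2)) μ]
    simp only [Complex.ofReal_sub, neg_mul]
  have h2 : ∫ x in (0:ℝ)..(c - μ), Complex.exp (-(I * A) * (x : ℂ) ^ 2)
      = ((c : ℂ) - μ) * ∫ t in (0:ℝ)..1, Complex.exp (-((t : ℂ) * (s * ((c : ℂ) - μ))) ^ 2) := by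
    have h := intervalIntegral.smul_integral_comp_mul_right
      (a := 0) (b := 1) (fun x : ℝ => Complex.exp (-(I * A) * (x : ℂ) ^ 2)) (c - μ)
    rw [zero_mul, one_mul] at h
    rw [← h, Complex.real_smul]
    push_cast
    congr 2
    ext t
    rw [← hs2]
    congr 1
    ring
  have h3 : (1 / 2 : ℂ) * P * cErfc (s * ((c : ℂ) - μ))
      = P / 2 - ∫ x in (0:ℝ)..(c - μ), Complex.exp (-(I * A) * (x : ℂ) ^ 2) := by
    rw [h2, cErfc, cErf, intervalIntegral.integral_const_mul]
    push_cast
    generalize (∫ t in (0:ℝ)..1, Complex.exp (-((t : ℂ) * (s * ((c : ℂ) - μ))) ^ 2)) = J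
    have h4 : P * s * (2 / ((Real.sqrt Real.pi : ℝ) : ℂ)) = 2 := by
      rw [hPs]; field_simp
    linear_combination (-(1 / 2 : ℂ) * ((c : ℂ) - μ) * J) * h4
  rw [h3]
  simp_rw [h1]
  exact ((fr_tendsto hA).comp (tendsto_atTop_add_const_right _ (-μ) tendsto_id)).sub_const _
end
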